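/- Let $F$ be an algebraically closed field of characteristic $2$ and $D_{2^{r+1}} = \langle \sigma, \rho \rangle$ the dihedral group of order $2^{r+1}$ with $\mathrm{ord}(\sigma) = 2$, $\mathrm{ord}(\rho) = 2^r$, $\sigma \rho \sigma^{-1} = \rho^{-1}$. Then for every faithful finite-dimensional $D_{2^{r+1}}$-module $V$ over $F$, we have $\delta(D_{2^{r+1}}, V) \ge 2^r$. -/

import Mathlib

open MvPolynomial

/-- The action of a matrix `A` on polynomials, substituting each variable `X i`
by the linear form `∑ j, A i j • X j`, so that `(matAct A f)(v) = f(A ⬝ v)`. -/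
noncomputable def matAct {F : Type*} [Field F] {N : ℕ} (A : Matrix (Fin N) (Fin N) F) :
    MvPolynomial (Fin N) F →ₐ[F] MvPolynomial (Fin N) F :=
  aeval fun i => ∑ j, C (A i j) * X j

/-- `f` is an invariant of the representation `ρ`: `σ(f) = f ∘ σ⁻¹ = f` for all `σ ∈ G`. -/
def IsInv {F : Type*} [Field F] {N : ℕ} {G : Type*} [Group G]
    (ρ : G →* Matrix.GeneralLinearGroup (Fin N) F) (f : MvPolynomial (Fin N) F) : Prop :=
  ∀ σ : G, matAct ((ρ σ⁻¹ : Matrix.GeneralLinearGroup (Fin N) F) : Matrix (Fin N) (Fin N) F) f = f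

/-- `v` is a fixed point of the representation `ρ`. -/
def IsFixedPt {F : Type*} [Field F] {N : ℕ} {G : Type*} [Group G]
    (ρ : G →* Matrix.GeneralLinearGroup (Fin N) F) (v : Fin N → F) : Prop :=
  ∀ σ : G, Matrix.mulVec ((ρ σ : Matrix.GeneralLinearGroup (Fin N) F) : Matrix (Fin N) (Fin N) F) v = v

/-- `ε(G,v)`: minimal positive degree of a homogeneous invariant not vanishing at `v`. -/
noncomputable def epsGV {F : Type*} [Field F] {N : ℕ} {G : Type*} [Group G]
    (ρ : G →* Matrix.GeneralLinearGroup (Fin N) F) (v : Fin N → F) : ℕ :=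
  sInf {d : ℕ | 0 < d ∧ ∃ f : MvPolynomial (Fin N) F,
    IsInv ρ f ∧ f.IsHomogeneous d ∧ eval v f ≠ 0}

/-- `δ(G,V)`: the degree of reductivity, i.e. the supremum of `ε(G,v)` over nonzero
fixed points `v` (and `0` if `V^G = {0}`). -/
noncomputable def deltaGV {F : Type*} [Field F] {N : ℕ} {G : Type*} [Group G]
    (ρ : G →* Matrix.GeneralLinearGroup (Fin N) F) : ℕ :=
  sSup {e : ℕ | ∃ v : Fin N → F, v ≠ 0 ∧ IsFixedPt ρ v ∧ e = epsGV ρ v}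

/-- A polynomial over a domain of characteristic two invariant under `X ↦ X + s`
is a polynomial in `X ^ 2 + s X`. -/
lemma exists_comp_of_inv {R : Type*} [CommRing R] [IsDomain R] [CharP R 2] (s : R) (hs : s ≠ 0)
    (n : ℕ) : ∀ P : Polynomial R, P.natDegree < n →
      P.comp (Polynomial.X + Polynomial.C s) = P →
      ∃ Q : Polynomial R, P = Q.comp (Polynomial.X ^ 2 + Polynomial.C s * Polynomial.X) := by
  induction n with
  | zero => intro P h; omega
  | succ n ih =>
    intro P hdeg hP
    set g : Polynomial R := Polynomial.X ^ 2 + Polynomial.C s * Polynomial.X with hg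
    have hgdeg : g.degree = 2 := by rw [hg]; compute_degree!
    have hgnat : g.natDegree = 2 := by rw [hg]; compute_degree!
    have hgm : g.Monic := by
      unfold Polynomial.Monic Polynomial.leadingCoeff
      rw [hgnat, hg]; simp
    have hginv : g.comp (Polynomial.X + Polynomial.C s) = g := by
      have h2 : (2 : Polynomial R) = 0 := CharTwo.two_eq_zero
      simp only [hg, Polynomial.add_comp, Polynomial.pow_comp, Polynomial.mul_comp,
        Polynomial.X_comp, Polynomial.C_comp]
      linear_combination (Polynomial.X * Polynomial.C s + Polynomial.C s ^ 2) * h2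
    have hdiv := Polynomial.modByMonic_add_div P g
    have hrdeg := Polynomial.degree_modByMonic_lt P hgm
    have hu := Polynomial.div_modByMonic_unique (f := P)
      ((P /ₘ g).comp (Polynomial.X + Polynomial.C s))
      ((P %ₘ g).comp (Polynomial.X + Polynomial.C s)) hgm (by
        constructor
        · nth_rewrite 2 [← hginv]
          rw [← Polynomial.mul_comp, ← Polynomial.add_comp, hdiv, hP]
        · have h1 : (P %ₘ g).natDegree ≤ 1 := by
            have := Polynomial.natDegree_modByMonic_lt P hgm (by
              intro h; rw [h] at hgnat; simp at hgnat)
            omega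
          rw [hgdeg]
          have h2 : ((P %ₘ g).comp (Polynomial.X + Polynomial.C s)).natDegree ≤ 1 := by
            rw [Polynomial.natDegree_comp, Polynomial.natDegree_X_add_C]; omega
          exact lt_of_le_of_lt (Polynomial.natDegree_le_iff_degree_le.1 h2) (by norm_num))
    obtain ⟨hq, hr⟩ := hu
    have h1 : (P %ₘ g).natDegree ≤ 1 := by
      have := Polynomial.natDegree_modByMonic_lt P hgm (by
        intro h; rw [h] at hgnat; simp at hgnat)
      omega
    obtain ⟨a, b, hab⟩ := Polynomial.exists_eq_X_add_C_of_natDegree_le_one h1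
    have ha : a = 0 := by
      rw [hab] at hr
      simp only [Polynomial.add_comp, Polynomial.mul_comp, Polynomial.X_comp,
        Polynomial.C_comp] at hr
      have : Polynomial.C (a * s) = 0 := by
        rw [Polynomial.C_mul]; linear_combination -hr
      rw [Polynomial.C_eq_zero] at this
      exact (mul_eq_zero.1 this).resolve_right hs
    have hab' : P %ₘ g = Polynomial.C b := by rw [hab, ha]; simp
    by_cases hlt : P.natDegree < 2
    · refine ⟨Polynomial.C b, ?_⟩
      have : P %ₘ g = P := (Polynomial.modByMonic_eq_self_iff hgm).2 (by
        rw [hgdeg]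
        exact lt_of_le_of_lt (Polynomial.natDegree_le_iff_degree_le.1 (Nat.lt_succ_iff.1 hlt))
          (by norm_num))
      rw [Polynomial.C_comp, ← hab', this]
    · obtain ⟨Q, hQ⟩ := ih (P /ₘ g) (by
        rw [Polynomial.natDegree_divByMonic _ hgm, hgnat]; omega) hq.symm
      refine ⟨Polynomial.X * Q + Polynomial.C b, ?_⟩
      rw [Polynomial.add_comp, Polynomial.mul_comp, Polynomial.X_comp, Polynomial.C_comp, ← hQ,
        ← hab', add_comm]
      exact hdiv.symm

/-- the shift on `F[a_i : i ∈ ℤ/n]`. -/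
noncomputable def shiftHom (F : Type*) [Field F] (n : ℕ) :
    MvPolynomial (ZMod n) F →+* MvPolynomial (ZMod n) F :=
  (rename (fun i : ZMod n => i + 1) : MvPolynomial (ZMod n) F →ₐ[F] MvPolynomial (ZMod n) F)

lemma shiftHom_X (F : Type*) [Field F] (n : ℕ) (i : ZMod n) :
    shiftHom F n (X i) = X (i + 1) := by simp [shiftHom]

lemma shiftHom_C (F : Type*) [Field F] (n : ℕ) (c : F) :
    shiftHom F n (C c) = C c := by simp [shiftHom]

lemma shiftHom_pow_X (F : Type*) [Field F] (n j : ℕ) (i : ZMod n) :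
    (shiftHom F n ^ j) (X i) = X (i + j) := by
  induction j with
  | zero => simp
  | succ j ih =>
    rw [pow_succ', RingHom.mul_def, RingHom.comp_apply, ih, shiftHom_X]; push_cast
    rw [add_assoc]

lemma shiftHom_pow_C (F : Type*) [Field F] (n j : ℕ) (c : F) :
    (shiftHom F n ^ j) (C c) = C c := by
  induction j with
  | zero => simp
  | succ j ih =>
    rw [pow_succ', RingHom.mul_def, RingHom.comp_apply, ih, shiftHom_C]

lemma shiftHom_pow_self (F : Type*) [Field F] (n : ℕ) :
    shiftHom F n ^ n = RingHom.id _ := by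
  apply MvPolynomial.ringHom_ext
  · intro c; rw [shiftHom_pow_C]; rfl
  · intro i; rw [shiftHom_pow_X]; simp

/-- iterating a twisted translation. -/
lemma iterate_twist {R : Type*} [CommRing R] (τ : R →+* R) (α : R) (P : Polynomial R)
    (hP : (P.map τ).comp (Polynomial.X + Polynomial.C α) = P) (n : ℕ) :
    (P.map (τ ^ n)).comp
      (Polynomial.X + Polynomial.C (∑ i ∈ Finset.range n, (τ ^ i) α)) = P := by
  induction n with
  | zero => simp [RingHom.one_def]
  | succ n ih =>
    have h2 : ((P.map (τ ^ (n+1)))).comp (Polynomial.X + Polynomial.C ((τ ^ n) α)) 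
        = P.map (τ ^ n) := by
      nth_rewrite 2 [← hP]
      rw [Polynomial.map_comp, Polynomial.map_map, pow_succ, RingHom.mul_def]
      simp
    nth_rewrite 2 [← ih]
    rw [← h2, Polynomial.comp_assoc, Finset.sum_range_succ]
    congr 1
    simp [add_assoc]

lemma comp_inj_of_natDegree_two {R : Type*} [CommRing R] [IsDomain R] {g P Q : Polynomial R}
    (hg : g.natDegree = 2) (h : P.comp g = Q.comp g) : P = Q := by
  have h0 : (P - Q).comp g = 0 := by rw [Polynomial.sub_comp, h, sub_self]
  have h1 : (P - Q).natDegree = 0 := by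
    have := congrArg Polynomial.natDegree h0
    rw [Polynomial.natDegree_comp, hg] at this
    simpa using this
  rw [Polynomial.eq_C_of_natDegree_eq_zero h1, Polynomial.C_comp] at h0
  rw [← sub_eq_zero, Polynomial.eq_C_of_natDegree_eq_zero h1, h0]

lemma sum_shift_ne_zero (F : Type*) [Field F] (n k : ℕ) (hn : 0 < n) (hk : 0 < k) :
    (∑ i ∈ Finset.range n, (shiftHom F n ^ i) (X 0 ^ k)) ≠ 0 := by
  intro h
  have := congrArg (eval (fun i : ZMod n => if i = 0 then (1 : F) else 0)) h
  simp only [map_sum, map_pow, shiftHom_pow_X, eval_X, map_zero, zero_add] at this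
  rw [Finset.sum_eq_single 0] at this
  · simp at this
  · intro b hb hb0
    rw [if_neg, zero_pow hk.ne']
    rw [ZMod.natCast_eq_zero_iff]
    intro hd
    exact absurd (Nat.le_of_dvd (Nat.pos_of_ne_zero hb0) hd) (by simpa using hb)
  · intro h0; simp at h0; omega

theorem key {F : Type*} [Field F] [CharP F 2] (m : ℕ) : ∀ (k : ℕ), 0 < k →
    ∀ P : Polynomial (MvPolynomial (ZMod (2 ^ m)) F), P.Monic →
    (P.map (shiftHom F (2 ^ m))).comp (Polynomial.X + Polynomial.C (X 0 ^ k)) = P →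
    2 ^ (m + 1) ∣ P.natDegree := by
  induction m with
  | zero =>
    intro k hk P hm hP
    have h1 := iterate_twist _ _ _ hP (2 ^ 0)
    rw [shiftHom_pow_self, Polynomial.map_id] at h1
    obtain ⟨Q, hQ⟩ := exists_comp_of_inv _
      (sum_shift_ne_zero F (2 ^ 0) k (by positivity) hk) _ P (Nat.lt_succ_self _) h1
    rw [hQ, Polynomial.natDegree_comp]
    refine Dvd.dvd.mul_left ?_ _
    apply dvd_of_eq
    symm
    compute_degree!
  | succ m ih =>
    intro k hk P hm hP
    have h1 := iterate_twist _ _ _ hP (2 ^ (m + 1))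
    rw [shiftHom_pow_self, Polynomial.map_id] at h1
    obtain ⟨Q, hQ⟩ := exists_comp_of_inv _
      (sum_shift_ne_zero F (2 ^ (m + 1)) k (by positivity) hk) _ P (Nat.lt_succ_self _) h1
    set τ := shiftHom F (2 ^ (m + 1)) with hτ
    set s := ∑ i ∈ Finset.range (2 ^ (m + 1)), (τ ^ i) (X 0 ^ k) with hs
    set g : Polynomial (MvPolynomial (ZMod (2 ^ (m + 1))) F) :=
      Polynomial.X ^ 2 + Polynomial.C s * Polynomial.X with hg
    have hgnat : g.natDegree = 2 := by rw [hg]; compute_degree!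
    have hgm : g.Monic := by
      unfold Polynomial.Monic Polynomial.leadingCoeff
      rw [hgnat, hg]; simp
    have hQm : Q.Monic := by
      have : P.leadingCoeff = 1 := hm
      rw [hQ, Polynomial.leadingCoeff_comp (by omega), hgm.leadingCoeff] at this
      rw [one_pow, mul_one] at this
      exact this
    have hτs : τ s = s := by
      have hx : ∀ i : ℕ, τ ((τ ^ i) (X 0 ^ k)) = (τ ^ (i + 1)) (X 0 ^ k) := by
        intro i; rw [pow_succ' τ i, RingHom.mul_def, RingHom.comp_apply]
      rw [hs, map_sum, Finset.sum_congr rfl (fun i _ => hx i)]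
      have e1 := Finset.sum_range_succ (fun i => (τ ^ i) ((X 0 : MvPolynomial (ZMod (2 ^ (m + 1))) F) ^ k)) (2 ^ (m + 1))
      have e2 := Finset.sum_range_succ' (fun i => (τ ^ i) ((X 0 : MvPolynomial (ZMod (2 ^ (m + 1))) F) ^ k)) (2 ^ (m + 1))
      rw [hτ, shiftHom_pow_self, ← hτ] at e1
      simp only [pow_zero, RingHom.one_def] at e2
      exact add_right_cancel (e2.symm.trans e1)
    have hgα : (g.map τ).comp (Polynomial.X + Polynomial.C (X 0 ^ k))
        = (Polynomial.X + Polynomial.C ((X 0 ^ k) ^ 2 + s * X 0 ^ k)).comp g := by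
      have h2 : (2 : Polynomial (MvPolynomial (ZMod (2 ^ (m + 1))) F)) = 0 :=
        CharTwo.two_eq_zero
      simp only [hg, Polynomial.map_add, Polynomial.map_mul, Polynomial.map_pow,
        Polynomial.map_X, Polynomial.map_C, hτs, Polynomial.add_comp, Polynomial.pow_comp,
        Polynomial.mul_comp, Polynomial.X_comp, Polynomial.C_comp, Polynomial.C_add,
        Polynomial.C_mul]
      rw [Polynomial.C_pow (n := 2)]
      linear_combination (Polynomial.X * Polynomial.C (X 0 ^ k)) * h2
    have hQinv : (Q.map τ).comp
        (Polynomial.X + Polynomial.C ((X 0 ^ k) ^ 2 + s * X 0 ^ k)) = Q := by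
      apply comp_inj_of_natDegree_two hgnat
      rw [Polynomial.comp_assoc, ← hgα, ← Polynomial.comp_assoc, ← Polynomial.map_comp, ← hQ, hP]
    -- specialise
    let φ : MvPolynomial (ZMod (2 ^ (m + 1))) F →+* MvPolynomial (ZMod (2 ^ m)) F :=
      (rename (ZMod.castHom (pow_dvd_pow 2 (Nat.le_succ m)) (ZMod (2 ^ m))) :
        MvPolynomial (ZMod (2 ^ (m + 1))) F →ₐ[F] MvPolynomial (ZMod (2 ^ m)) F)
    have hφX : ∀ i, φ (X i) =
        X (ZMod.castHom (pow_dvd_pow 2 (Nat.le_succ m)) (ZMod (2 ^ m)) i) := by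
      intro i; exact rename_X _ _
    have hφC : ∀ c, φ (C c) = C c := by
      intro c; exact rename_C _ _
    have hφτ : φ.comp τ = (shiftHom F (2 ^ m)).comp φ := by
      apply MvPolynomial.ringHom_ext
      · intro c
        simp only [RingHom.comp_apply, hτ, shiftHom_C, hφC]
      · intro i
        simp only [RingHom.comp_apply, hτ, shiftHom_X, hφX, map_add, map_one]
    have hφs : φ s = 0 := by
      have e : ∀ i : ℕ, φ ((τ ^ i) (X 0 ^ k)) = X (i : ZMod (2 ^ m)) ^ k := by
        intro i
        rw [map_pow, hτ, shiftHom_pow_X, map_pow, hφX, zero_add, map_natCast]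
      rw [hs, map_sum, Finset.sum_congr rfl (fun i _ => e i), pow_succ, mul_two,
        Finset.sum_range_add]
      have ee : ∀ i : ℕ, (X ((2 ^ m + i : ℕ) : ZMod (2 ^ m)) ^ k :
          MvPolynomial (ZMod (2 ^ m)) F) = X (i : ZMod (2 ^ m)) ^ k := by
        intro i
        rw [Nat.cast_add, ZMod.natCast_self, zero_add]
      rw [Finset.sum_congr rfl (fun i _ => ee i)]
      exact CharTwo.add_self_eq_zero _
    have hfin := ih (k * 2) (by omega) (Q.map φ) (hQm.map φ) (by
      have := congrArg (Polynomial.map φ) hQinv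
      rw [Polynomial.map_comp, Polynomial.map_map, hφτ, ← Polynomial.map_map] at this
      simpa [hφs, hφX, ← pow_mul] using this)
    rw [hQm.natDegree_map] at hfin
    rw [hQ, Polynomial.natDegree_comp, hgnat, pow_succ]
    exact Nat.mul_dvd_mul_right hfin 2

section transfer

variable {F : Type*} [Field F] {N : ℕ}

lemma matAct_X (A : Matrix (Fin N) (Fin N) F) (i : Fin N) :
    matAct A (X i) = ∑ j, C (A i j) * X j := by simp [matAct]

lemma matAct_matAct (A B : Matrix (Fin N) (Fin N) F) (f : MvPolynomial (Fin N) F) :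
    matAct B (matAct A f) = matAct (A * B) f := by
  have : (matAct B).comp (matAct A) = matAct (A * B) := by
    apply MvPolynomial.algHom_ext
    intro i
    simp only [AlgHom.comp_apply, matAct_X, map_sum, map_mul, algHom_C, algebraMap_eq,
      Matrix.mul_apply, Finset.sum_mul, Finset.mul_sum]
    rw [Finset.sum_comm]
    simp only [mul_assoc]
  exact DFunLike.congr_fun this f

lemma eval_matAct (A : Matrix (Fin N) (Fin N) F) (v : Fin N → F) (f : MvPolynomial (Fin N) F) :
    eval v (matAct A f) = eval (A.mulVec v) f := by
  have : (aeval v).comp (matAct A) =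
      (aeval (A.mulVec v) : MvPolynomial (Fin N) F →ₐ[F] F) := by
    apply MvPolynomial.algHom_ext
    intro i
    simp [matAct_X, Matrix.mulVec, dotProduct]
  have := DFunLike.congr_fun this f
  simpa [MvPolynomial.aeval_eq_eval] using this

lemma top_coeff {R : Type*} [CommRing R] [Algebra F R] (c : Fin N → R) (v : Fin N → F) (d : ℕ)
    (f : MvPolynomial (Fin N) F) (hf : f.IsHomogeneous d) :
    (aeval (fun j => Polynomial.C (c j) + Polynomial.C (algebraMap F R (v j)) * Polynomial.X) f :
      Polynomial R).natDegree ≤ d ∧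
    (aeval (fun j => Polynomial.C (c j) + Polynomial.C (algebraMap F R (v j)) * Polynomial.X) f :
      Polynomial R).coeff d = algebraMap F R (eval v f) := by
  set L : Fin N → Polynomial R :=
    fun j => Polynomial.C (c j) + Polynomial.C (algebraMap F R (v j)) * Polynomial.X with hL
  have hL1 : ∀ j, (L j).natDegree ≤ 1 := by intro j; rw [hL]; dsimp only; compute_degree
  have hL2 : ∀ j, (L j).coeff 1 = algebraMap F R (v j) := by
    intro j; simp [hL, Polynomial.coeff_C]
  have hprod : ∀ (s : Fin N →₀ ℕ) (T : Finset (Fin N)),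
      (∏ j ∈ T, L j ^ s j).natDegree ≤ ∑ j ∈ T, s j ∧
      (∏ j ∈ T, L j ^ s j).coeff (∑ j ∈ T, s j) = algebraMap F R (∏ j ∈ T, v j ^ s j) := by
    intro s T
    induction T using Finset.induction_on with
    | empty => simp
    | insert a T ha ih =>
      rw [Finset.prod_insert ha, Finset.sum_insert ha, Finset.prod_insert ha]
      have h1 : (L a ^ s a).natDegree ≤ s a := by
        have := Polynomial.natDegree_pow_le_of_le (s a) (hL1 a)
        simpa using this
      have h2 : (L a ^ s a).coeff (s a) = algebraMap F R (v a ^ s a) := by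
        have := Polynomial.coeff_pow_of_natDegree_le (hL1 a) (m := s a)
        rw [hL2, mul_one] at this
        rw [this, map_pow]
      refine ⟨Polynomial.natDegree_mul_le_of_le h1 ih.1, ?_⟩
      rw [Polynomial.coeff_mul_add_eq_of_natDegree_le h1 ih.1, h2, ih.2, map_mul]
  have hmon : ∀ s ∈ f.support, ∑ j, s j = d := by
    intro s hs
    have := hf (mem_support_iff.1 hs)
    rw [← this, Finsupp.weight_apply, Finsupp.sum_fintype] <;> simp
  rw [MvPolynomial.aeval_def, MvPolynomial.eval₂_eq', MvPolynomial.eval_eq']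
  constructor
  · apply Polynomial.natDegree_sum_le_of_forall_le
    intro s hs
    refine (Polynomial.natDegree_C_mul_le _ _).trans ?_
    rw [← hmon s hs]
    exact (hprod s _).1
  · rw [Polynomial.finsetSum_coeff, map_sum]
    apply Finset.sum_congr rfl
    intro s hs
    rw [Polynomial.algebraMap_apply, Polynomial.coeff_C_mul, ← hmon s hs, (hprod s _).2, map_mul]

theorem degree_dvd [CharP F 2] (m : ℕ) (A : Matrix (Fin N) (Fin N) F) (u : ℕ → Fin N → F)
    (v : Fin N → F) (hv : A.mulVec v = v) (hu : ∀ i, A.mulVec (u (i + 1)) = u i)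
    (hu0 : A.mulVec (u 0) = u (2 ^ m - 1) + v) (f : MvPolynomial (Fin N) F) (d : ℕ)
    (hf : f.IsHomogeneous d) (hfv : eval v f ≠ 0) (hinv : matAct A f = f) :
    2 ^ (m + 1) ∣ d := by
  let R := MvPolynomial (ZMod (2 ^ m)) F
  let c : Fin N → R := fun j => ∑ i ∈ Finset.range (2 ^ m), X (i : ZMod (2 ^ m)) * C (u i j)
  let ψ : MvPolynomial (Fin N) F →ₐ[F] Polynomial R :=
    aeval (fun j => Polynomial.C (c j) + Polynomial.C (algebraMap F R (v j)) * Polynomial.X)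
  obtain ⟨h1, h2⟩ := top_coeff c v d f hf
  change (ψ f).natDegree ≤ d at h1
  change (ψ f).coeff d = C (eval v f) at h2
  have hψX : ∀ j, ψ (X j) = Polynomial.C (c j) + Polynomial.C (C (v j)) * Polynomial.X := by
    intro j; exact aeval_X _ _
  have hψC : ∀ a, ψ (C a) = Polynomial.C (C a) := by
    intro a; exact aeval_C _ _
  let θ : Polynomial R →+* Polynomial R :=
    (Polynomial.compRingHom (Polynomial.X + Polynomial.C (X 0))).comp
      (Polynomial.mapRingHom (shiftHom F (2 ^ m)))
  have hθ : ∀ p, θ p = (p.map (shiftHom F (2 ^ m))).comp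
    (Polynomial.X + Polynomial.C (X 0)) := fun p => rfl
  have hc : ∀ j, ∑ l, C (A j l) * c l = shiftHom F (2 ^ m) (c j) + X 0 * C (v j) := by
    intro j
    have hAu : ∀ i, ∑ l, A j l * u i l = (A.mulVec (u i)) j := fun i => rfl
    have e1 : ∑ l, C (A j l) * c l =
        ∑ i ∈ Finset.range (2 ^ m), X (i : ZMod (2 ^ m)) * C ((A.mulVec (u i)) j) := by
      simp only [c, Finset.mul_sum]
      rw [Finset.sum_comm]
      apply Finset.sum_congr rfl
      intro i _
      rw [← hAu, map_sum, Finset.mul_sum]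
      apply Finset.sum_congr rfl
      intro l _
      rw [C_mul]; ring
    have e2 : shiftHom F (2 ^ m) (c j) =
        ∑ i ∈ Finset.range (2 ^ m), X ((i + 1 : ℕ) : ZMod (2 ^ m)) * C (u i j) := by
      simp only [c, map_sum, map_mul, shiftHom_X, shiftHom_C]
      push_cast; rfl
    rw [e1, e2]
    obtain ⟨q, hq⟩ : ∃ q, 2 ^ m = q + 1 := ⟨2 ^ m - 1, (Nat.sub_add_cancel Nat.one_le_two_pow).symm⟩
    have hz : ((q + 1 : ℕ) : ZMod (2 ^ m)) = 0 := by rw [← hq]; simp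
    have e3 : Finset.range (2 ^ m) = Finset.range (q + 1) := by rw [hq]
    rw [e3, Finset.sum_range_succ', Finset.sum_range_succ, hu0, hz]
    have e4 : 2 ^ m - 1 = q := by omega
    simp only [hu, e4, Pi.add_apply, Nat.cast_zero, C_add]
    ring
  have hcomm : ((ψ : MvPolynomial (Fin N) F →+* Polynomial R)).comp
      (matAct A : MvPolynomial (Fin N) F →+* MvPolynomial (Fin N) F) =
      θ.comp (ψ : MvPolynomial (Fin N) F →+* Polynomial R) := by
    apply MvPolynomial.ringHom_ext
    · intro a
      simp only [RingHom.comp_apply, RingHom.coe_coe, hψC, hθ]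
      rw [show matAct A (C a) = C a from aeval_C _ _, hψC]
      simp [shiftHom_C]
    · intro j
      simp only [RingHom.comp_apply, RingHom.coe_coe, hψX, hθ, matAct_X, map_sum, map_mul, hψC]
      have hAv : ∑ l, A j l * v l = v j := congrFun hv j
      have e5 : ∑ l, (Polynomial.C (C (A j l)) : Polynomial R) *
          (Polynomial.C (c l) + Polynomial.C (C (v l)) * Polynomial.X) =
          Polynomial.C (∑ l, C (A j l) * c l) +
            Polynomial.C (C (∑ l, A j l * v l)) * Polynomial.X := by
        simp only [map_sum, map_mul, Finset.sum_mul, ← Finset.sum_add_distrib]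
        apply Finset.sum_congr rfl
        intro l _; ring
      rw [e5, hc, hAv]
      simp only [Polynomial.map_add, Polynomial.map_mul, Polynomial.map_C, Polynomial.map_X,
        Polynomial.add_comp, Polynomial.mul_comp, Polynomial.C_comp, Polynomial.X_comp,
        shiftHom_C, Polynomial.C_add, Polynomial.C_mul]
      ring
  have hP : θ (ψ f) = ψ f := by
    have := DFunLike.congr_fun hcomm f
    simp only [RingHom.comp_apply, RingHom.coe_coe, hinv] at this
    exact this.symm
  -- normalise
  let a := eval v f
  let P : Polynomial R := Polynomial.C (C a⁻¹) * ψ f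
  have hPc : P.coeff d = 1 := by
    rw [Polynomial.coeff_C_mul, h2, ← C_mul, inv_mul_cancel₀ hfv, C_1]
  have hPd : P.natDegree ≤ d := (Polynomial.natDegree_C_mul_le _ _).trans h1
  have hPm : P.Monic := Polynomial.monic_of_natDegree_le_of_coeff_eq_one d hPd hPc
  have hPn : P.natDegree = d := le_antisymm hPd
    (Polynomial.le_natDegree_of_ne_zero (by rw [hPc]; exact one_ne_zero))
  have := key m 1 one_pos P hPm (by
    rw [pow_one, ← hθ]
    simp only [P, map_mul, hP]
    congr 1
    rw [hθ]; simp [shiftHom_C])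
  rwa [hPn] at this

end transfer

section bounded

variable {F : Type*} [Field F] {N : ℕ} {G : Type*} [Group G] [Fintype G]

lemma eps_set_mem (ρ : G →* Matrix.GeneralLinearGroup (Fin N) F) (v : Fin N → F)
    (hv : v ≠ 0) (hfix : IsFixedPt ρ v) :
    Fintype.card G ∈ {d : ℕ | 0 < d ∧ ∃ f : MvPolynomial (Fin N) F,
    IsInv ρ f ∧ f.IsHomogeneous d ∧ eval v f ≠ 0} := by
  obtain ⟨j, hj⟩ := Function.ne_iff.1 hv
  refine ⟨Fintype.card_pos, ∏ g : G, matAct (ρ g : Matrix (Fin N) (Fin N) F) (X j), ?_, ?_, ?_⟩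
  · intro σ
    rw [map_prod]
    refine Fintype.prod_equiv (Equiv.mulRight σ⁻¹) _ _ ?_
    intro g
    rw [matAct_matAct]
    simp
  · have := IsHomogeneous.prod Finset.univ
      (fun g : G => matAct (ρ g : Matrix (Fin N) (Fin N) F) (X j)) (fun _ => 1) (by
        intro g _
        rw [matAct_X]
        apply IsHomogeneous.sum
        intro l _
        have := (isHomogeneous_C (Fin N) ((ρ g : Matrix (Fin N) (Fin N) F) j l)).mul
          (isHomogeneous_X F l)
        simpa using this)
    simpa using this
  · rw [map_prod, Finset.prod_ne_zero_iff]
    intro g _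
    rw [eval_matAct, hfix g, eval_X]
    exact hj

lemma le_delta (ρ : G →* Matrix.GeneralLinearGroup (Fin N) F) (v : Fin N → F)
    (hv : v ≠ 0) (hfix : IsFixedPt ρ v) (n : ℕ)
    (h : ∀ d : ℕ, 0 < d → ∀ f : MvPolynomial (Fin N) F, IsInv ρ f → f.IsHomogeneous d →
      eval v f ≠ 0 → n ≤ d) : n ≤ deltaGV ρ := by
  have h1 : n ≤ epsGV ρ v := by
    obtain ⟨h0, f, hf1, hf2, hf3⟩ := Nat.sInf_mem ⟨_, eps_set_mem ρ v hv hfix⟩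
    exact h _ h0 f hf1 hf2 hf3
  refine h1.trans (le_csSup ?_ ⟨v, hv, hfix, rfl⟩)
  refine ⟨Fintype.card G, ?_⟩
  rintro e ⟨v', hv', hfix', rfl⟩
  exact Nat.sInf_le (eps_set_mem ρ v' hv' hfix')

end bounded

/-- In a subset of a dihedral representation stable under the relevant operations and containing a
nonzero vector, there is a nonzero fixed vector. -/
lemma exists_fixed {F : Type*} [Field F] [CharP F 2] (r : ℕ) {N : ℕ}
    (ρ : DihedralGroup (2 ^ r) →* Matrix.GeneralLinearGroup (Fin N) F)
    (W : Submodule F (Fin N → F))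
    (hW : ∀ g, ∀ x ∈ W, (ρ g : Matrix (Fin N) (Fin N) F).mulVec x ∈ W)
    (y : Fin N → F) (hy : y ∈ W) (hy0 : y ≠ 0) :
    ∃ v ∈ W, v ≠ 0 ∧ IsFixedPt ρ v := by
  let M : DihedralGroup (2 ^ r) → Matrix (Fin N) (Fin N) F := fun g => (ρ g : Matrix (Fin N) (Fin N) F)
  have hM : ∀ g h, M (g * h) = M g * M h := by intro g h; simp [M]
  have hM1 : M 1 = 1 := by simp [M]
  have hMp : ∀ g (n : ℕ), M (g ^ n) = M g ^ n := by intro g n; simp [M]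
  set A := M (DihedralGroup.r 1) with hA
  set S := M (DihedralGroup.sr 0) with hS
  have hAp : A ^ (2 ^ r) = 1 := by
    rw [hA, ← hMp, DihedralGroup.r_one_pow_n, hM1]
  have hB : (A - 1) ^ (2 ^ r) = 0 := by
    rcases Nat.eq_zero_or_pos N with h0 | hpos
    · subst h0; exact Subsingleton.elim _ _
    have : NeZero N := ⟨hpos.ne'⟩
    have : CharP (Matrix (Fin N) (Fin N) F) 2 := inferInstance
    rw [sub_pow_char_pow_of_commute _ _ (Commute.one_right A), hAp, one_pow, sub_self]
  have hBW : ∀ x ∈ W, (A - 1).mulVec x ∈ W := by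
    intro x hx
    rw [Matrix.sub_mulVec, Matrix.one_mulVec]
    exact W.sub_mem (hW _ x hx) hx
  have hBnW : ∀ n : ℕ, ((A - 1) ^ n).mulVec y ∈ W := by
    intro n
    induction n with
    | zero => simpa using hy
    | succ n ih =>
      rw [pow_succ', ← Matrix.mulVec_mulVec]; exact hBW _ ih
  have hex : ∃ n, ((A - 1) ^ n).mulVec y = 0 := ⟨2 ^ r, by rw [hB, Matrix.zero_mulVec]⟩
  classical
  obtain ⟨n, hn⟩ : ∃ n, Nat.find hex = n + 1 := by
    apply Nat.exists_eq_succ_of_ne_zero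
    intro h
    have := Nat.find_spec hex
    rw [h] at this
    simp at this
    exact hy0 this
  set x := ((A - 1) ^ n).mulVec y with hx
  have hx0 : x ≠ 0 := Nat.find_min hex (by omega)
  have hAx : A.mulVec x = x := by
    have := Nat.find_spec hex
    rw [hn, pow_succ', ← Matrix.mulVec_mulVec, Matrix.sub_mulVec, Matrix.one_mulVec] at this
    exact sub_eq_zero.1 this
  have hxW : x ∈ W := hBnW n
  have hSS : ∀ z, S.mulVec (S.mulVec z) = z := by
    intro z
    rw [Matrix.mulVec_mulVec, hS, ← hM]; simp [hM1]
  have hASA : A * S * A = S := by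
    rw [hA, hS, ← hM, ← hM]; simp
  have hASx : A.mulVec (S.mulVec x) = S.mulVec x := by
    nth_rewrite 1 [← hAx]
    rw [Matrix.mulVec_mulVec, Matrix.mulVec_mulVec, hASA]
  have hfixAll : ∀ v, A.mulVec v = v → S.mulVec v = v → IsFixedPt ρ v := by
    intro v hAv hSv
    have hr : ∀ n : ℕ, (M (DihedralGroup.r (n : ZMod (2 ^ r)))).mulVec v = v := by
      intro n
      induction n with
      | zero =>
        rw [Nat.cast_zero, show (DihedralGroup.r 0 : DihedralGroup (2 ^ r)) = 1 from rfl, hM1,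
          Matrix.one_mulVec]
      | succ n ih =>
        rw [Nat.cast_succ, ← DihedralGroup.r_mul_r, hM, ← Matrix.mulVec_mulVec, ← hA, hAv, ih]
    have hr' : ∀ i : ZMod (2 ^ r), (M (DihedralGroup.r i)).mulVec v = v := by
      intro i
      have := hr i.val
      rwa [ZMod.natCast_zmod_val] at this
    intro g
    change (M g).mulVec v = v
    rcases g with i | i
    · exact hr' i
    · have : (DihedralGroup.sr i : DihedralGroup (2 ^ r)) = DihedralGroup.sr 0 * DihedralGroup.r i := by
        simp
      rw [this, hM, ← Matrix.mulVec_mulVec, hr' i, ← hS, hSv]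
  by_cases hSx : S.mulVec x = x
  · exact ⟨x, hxW, hx0, hfixAll x hAx hSx⟩
  · refine ⟨x + S.mulVec x, W.add_mem hxW (hW _ x hxW), ?_, hfixAll _ ?_ ?_⟩
    · intro h
      apply hSx
      funext i
      have := congrFun h i
      simp only [Pi.add_apply, Pi.zero_apply] at this
      exact (CharTwo.add_eq_zero.1 this).symm
    · rw [Matrix.mulVec_add, hAx, hASx]
    · rw [Matrix.mulVec_add, hSS, add_comm]

theorem stmt8 {F : Type*} [Field F] [IsAlgClosed F] [CharP F 2]
    (r : ℕ) {N : ℕ} (hN : 0 < N)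
    (ρ : DihedralGroup (2 ^ r) →* Matrix.GeneralLinearGroup (Fin N) F)
    (hfaithful : Function.Injective ρ) :
    2 ^ r ≤ deltaGV ρ := by
  rcases r with _ | m
  · obtain ⟨v, -, hv0, hv⟩ := exists_fixed 0 ρ ⊤ (by simp) (fun _ => 1) trivial (by
      intro h; have := congrFun h ⟨0, hN⟩; simp at this)
    exact le_delta ρ v hv0 hv _ (fun d hd _ _ _ _ => by rw [pow_zero]; exact hd)
  · let M : DihedralGroup (2 ^ (m + 1)) → Matrix (Fin N) (Fin N) F :=
      fun g => (ρ g : Matrix (Fin N) (Fin N) F)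
    have hM : ∀ g h, M (g * h) = M g * M h := by intro g h; simp [M]
    let z : DihedralGroup (2 ^ (m + 1)) := DihedralGroup.r ((2 ^ m : ℕ) : ZMod (2 ^ (m + 1)))
    have hzz : -((2 ^ m : ℕ) : ZMod (2 ^ (m + 1))) = ((2 ^ m : ℕ) : ZMod (2 ^ (m + 1))) := by
      rw [neg_eq_iff_add_eq_zero, ← Nat.cast_add, ← two_mul, ← pow_succ', ZMod.natCast_self]
    have hz1 : z ≠ 1 := by
      intro h
      have h' : ((2 ^ m : ℕ) : ZMod (2 ^ (m + 1))) = 0 := by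
        have h2 : z = DihedralGroup.r 0 := h
        exact DihedralGroup.r.inj h2
      rw [ZMod.natCast_eq_zero_iff] at h'
      have := Nat.le_of_dvd (by positivity) h'
      rw [pow_succ] at this
      have : 0 < 2 ^ m := by positivity
      omega
    have hzc : ∀ g, g * z = z * g := by
      intro g
      rcases g with i | i
      · simp [z, add_comm]
      · simp only [z, DihedralGroup.sr_mul_r, DihedralGroup.r_mul_sr]
        rw [sub_eq_add_neg, hzz]
    have hMz : M z ≠ 1 := by
      intro h
      apply hz1
      apply hfaithful
      rw [map_one]
      exact Units.ext h
    let W : Submodule F (Fin N → F) := LinearMap.range (Matrix.mulVecLin (M z - 1))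
    have hW : ∀ g, ∀ x ∈ W, (ρ g : Matrix (Fin N) (Fin N) F).mulVec x ∈ W := by
      rintro g _ ⟨w, rfl⟩
      refine ⟨(M g).mulVec w, ?_⟩
      change (M z - 1).mulVec ((M g).mulVec w) = (M g).mulVec ((M z - 1).mulVec w)
      rw [Matrix.mulVec_mulVec, Matrix.mulVec_mulVec, sub_mul, mul_sub, ← hM, ← hM, hzc, one_mul,
        mul_one]
    obtain ⟨y, hy⟩ : ∃ w, (M z - 1).mulVec w ≠ 0 := by
      by_contra! h
      apply hMz
      rw [← sub_eq_zero]
      apply Matrix.ext_of_mulVec_single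
      intro i
      rw [h, Matrix.zero_mulVec]
    obtain ⟨v, ⟨w, hw⟩, hv0, hv⟩ := exists_fixed (m + 1) ρ W hW _ ⟨y, rfl⟩ hy
    have hw' : (M z).mulVec w = w + v := by
      have : (M z - 1).mulVec w = v := hw
      rw [Matrix.sub_mulVec, Matrix.one_mulVec] at this
      rw [← this]; abel
    refine le_delta ρ v hv0 hv _ ?_
    intro d hd f hf hfd hfv
    refine Nat.le_of_dvd hd ?_
    refine degree_dvd m (M (DihedralGroup.r 1))
      (fun i => (M (DihedralGroup.r (-(i : ZMod (2 ^ (m + 1)))))).mulVec w) v (hv _) ?_ ?_ f d hfd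
      hfv ?_
    · intro i
      rw [Matrix.mulVec_mulVec, ← hM, DihedralGroup.r_mul_r]
      push_cast
      congr 3
      ring
    · have hz0 : z = z := rfl
      have e : (DihedralGroup.r 1 : DihedralGroup (2 ^ (m + 1))) =
          DihedralGroup.r (-((2 ^ m - 1 : ℕ) : ZMod (2 ^ (m + 1)))) * z := by
        simp only [z, DihedralGroup.r_mul_r]
        rw [Nat.cast_sub Nat.one_le_two_pow]
        congr 1
        push_cast
        ring
      rw [Matrix.mulVec_mulVec, ← hM, Nat.cast_zero, neg_zero, DihedralGroup.r_mul_r, add_zero, e,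
        hM, ← Matrix.mulVec_mulVec, hw', Matrix.mulVec_add]
      congr 1
      exact hv _
    · have := hf (DihedralGroup.r 1)⁻¹
      rwa [inv_inv] at this
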